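/- Let P be a finite point set in general position, and let U be a finite multiset of empty convex polygons with vertices in P such that every i-wedge (face of the arrangement of P incident to some point i ∈ P) is covered by exactly one polygon of U. Then every bounded face of the arrangement of P is covered by exactly one polygon of U; that is, U is a convex partition of P. -/

import Mathlib

open Set

attribute [local instance] Classical.propDecidable

abbrev Pt : Type := ℝ × ℝ

/-- cross(k,l,m) = (l-k) × (m-l), positive iff (k,l,m) is positively oriented. -/
def cross (k l m : Pt) : ℝ :=
  (l.1 - k.1) * (m.2 - l.2) - (l.2 - k.2) * (m.1 - l.1)

/-- No three distinct points of `P` are collinear. -/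
def GenPos (P : Finset Pt) : Prop :=
  ∀ k ∈ P, ∀ l ∈ P, ∀ m ∈ P, k ≠ l → l ≠ m → k ≠ m → cross k l m ≠ 0

/-- The points of `P` on the boundary of the convex hull (extreme points). -/
noncomputable def hullPts (P : Finset Pt) : Finset Pt :=
  P.filter (fun x => x ∈ Set.extremePoints ℝ (convexHull ℝ (P : Set Pt)))

/-- Union of all segments determined by pairs of points of `P`. -/
def arrUnion (P : Finset Pt) : Set Pt :=
  ⋃ a ∈ P, ⋃ b ∈ P, segment ℝ a b

/-- A bounded face of the arrangement of all segments determined by `P`: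
a bounded connected component of the complement of the union of the segments. -/
def IsBoundedFace (P : Finset Pt) (F : Set Pt) : Prop :=
  (∃ x, x ∉ arrUnion P ∧ F = connectedComponentIn (arrUnion P)ᶜ x) ∧
  Bornology.IsBounded F

/-- An empty convex polygon with vertex set `p ⊆ P`: at least 3 vertices, each vertex is
an extreme point of the hull of `p`, and no point of `P` lies in the interior. -/
def IsEmptyPolygon (P p : Finset Pt) : Prop :=
  p ⊆ P ∧ 3 ≤ p.card ∧
  (∀ v ∈ p, v ∈ Set.extremePoints ℝ (convexHull ℝ (p : Set Pt))) ∧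
  ∀ x ∈ P, x ∉ interior (convexHull ℝ (p : Set Pt))

/-- `{a,b}` is an edge of the polygon with vertex set `p`: a segment between two
distinct vertices lying on the boundary of the polygon. -/
def IsEdgeOf (p : Finset Pt) (a b : Pt) : Prop :=
  a ∈ p ∧ b ∈ p ∧ a ≠ b ∧
  segment ℝ a b ⊆ frontier (convexHull ℝ (p : Set Pt))

/-- A convex partition of `P`: a finite set of empty convex polygons with vertices in `P`,
pairwise interior-disjoint, whose union is the convex hull of `P`. -/
def IsConvexPartition (P : Finset Pt) (U : Finset (Finset Pt)) : Prop :=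
  (∀ p ∈ U, IsEmptyPolygon P p) ∧
  (∀ p ∈ U, ∀ q ∈ U, p ≠ q →
    interior (convexHull ℝ (p : Set Pt)) ∩ interior (convexHull ℝ (q : Set Pt)) = ∅) ∧
  (⋃ p ∈ U, convexHull ℝ (p : Set Pt)) = convexHull ℝ (P : Set Pt)

open Filter Topology

lemma cross_swap (a b z : Pt) : cross b a z = - cross a b z := by
  simp only [cross]; ring

lemma cross_rot (a b z : Pt) : cross b z a = cross a b z := by
  simp only [cross]; ring

lemma cross_cont (a b : Pt) : Continuous (fun z => cross a b z) := by
  unfold cross; fun_prop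

/-- cross is affine in the last coordinate -/
lemma cross_combo (a b x y : Pt) (s t : ℝ) (h : s + t = 1) :
    cross a b (s • x + t • y) = s * cross a b x + t * cross a b y := by
  obtain rfl : s = 1 - t := by linarith
  simp only [cross, Prod.fst_add, Prod.snd_add, Prod.smul_fst, Prod.smul_snd, smul_eq_mul]; ring

lemma cross_left (a b : Pt) : cross a b a = 0 := by simp only [cross]; ring
lemma cross_right (a b : Pt) : cross a b b = 0 := by simp only [cross]; ring

lemma cross_of_mem_segment {a b w : Pt} (h : w ∈ segment ℝ a b) : cross a b w = 0 := by
  obtain ⟨s, t, hs, ht, hst, rfl⟩ := h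
  rw [cross_combo _ _ _ _ _ _ hst, cross_left, cross_right]; ring

lemma convex_cross_nonneg (a b : Pt) : Convex ℝ {z | 0 ≤ cross a b z} := by
  intro x hx y hy s t hs ht hst
  simp only [Set.mem_ofPred_eq] at *
  rw [cross_combo _ _ _ _ _ _ hst]; positivity

lemma sq_pos_of_ne {a b : Pt} (h : a ≠ b) : 0 < (b.1 - a.1)^2 + (b.2 - a.2)^2 := by
  by_contra hc
  apply h
  have h1 : b.1 - a.1 = 0 := by nlinarith [sq_nonneg (b.1 - a.1), sq_nonneg (b.2 - a.2)]
  have h2 : b.2 - a.2 = 0 := by nlinarith [sq_nonneg (b.1 - a.1), sq_nonneg (b.2 - a.2)]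
  exact Prod.ext (by linarith) (by linarith)

/-- a point on the line -/
lemma exists_of_cross_zero {a b z : Pt} (h : a ≠ b) (hz : cross a b z = 0) :
    ∃ t : ℝ, z = AffineMap.lineMap a b t := by
  have hp := sq_pos_of_ne h
  refine ⟨((z.1 - a.1) * (b.1 - a.1) + (z.2 - a.2) * (b.2 - a.2)) /
    ((b.1 - a.1)^2 + (b.2 - a.2)^2), ?_⟩
  simp only [cross] at hz
  simp only [AffineMap.lineMap_apply, vsub_eq_sub, vadd_eq_add]
  ext
  · simp only [Prod.fst_add, Prod.smul_fst, Prod.fst_sub, smul_eq_mul]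
    field_simp
    linear_combination -(b.2 - a.2) * hz
  · simp only [Prod.snd_add, Prod.smul_snd, Prod.snd_sub, smul_eq_mul]
    field_simp
    linear_combination (b.1 - a.1) * hz

lemma mem_triangle {a b q z : Pt} (h : 0 < cross a b q) (h1 : 0 ≤ cross b q z)
    (h2 : 0 ≤ cross q a z) (h3 : 0 ≤ cross a b z) {S : Set Pt} (hS : Convex ℝ S)
    (ha : a ∈ S) (hb : b ∈ S) (hq : q ∈ S) : z ∈ S := by
  have hsum : cross b q z + cross q a z + cross a b z = cross a b q := by
    simp only [cross]; ring
  have key : z = (cross b q z / cross a b q) • a + (cross q a z / cross a b q) • b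
      + (cross a b z / cross a b q) • q := by
    ext
    · simp only [Prod.fst_add, Prod.smul_fst, smul_eq_mul]
      field_simp
      simp only [cross]; ring
    · simp only [Prod.snd_add, Prod.smul_snd, smul_eq_mul]
      field_simp
      simp only [cross]; ring
  rw [key]
  have := hS.sum_mem (t := Finset.univ) (w := ![cross b q z / cross a b q, cross q a z / cross a b q,
    cross a b z / cross a b q]) (z := ![a, b, q]) ?_ ?_ ?_
  · simpa [Fin.sum_univ_three] using this
  · intro i _; fin_cases i <;> simp <;> positivity
  · simp [Fin.sum_univ_three]; field_simp; exact hsum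
  · intro i _; fin_cases i <;> simpa

lemma interior_triangle {a b q : Pt} (h : 0 < cross a b q) {S : Set Pt} (hS : Convex ℝ S)
    (ha : a ∈ S) (hb : b ∈ S) (hq : q ∈ S) : (interior S).Nonempty := by
  have hO : IsOpen {z | 0 < cross b q z ∧ 0 < cross q a z ∧ 0 < cross a b z} :=
    (isOpen_lt continuous_const (cross_cont b q)).inter
      ((isOpen_lt continuous_const (cross_cont q a)).inter
        (isOpen_lt continuous_const (cross_cont a b)))
  have hsub : {z | 0 < cross b q z ∧ 0 < cross q a z ∧ 0 < cross a b z} ⊆ S :=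
    fun z hz => mem_triangle h hz.1.le hz.2.1.le hz.2.2.le hS ha hb hq
  refine ⟨((a.1 + b.1 + q.1)/3, (a.2 + b.2 + q.2)/3), interior_maximal hsub hO ?_⟩
  simp only [cross] at h
  refine ⟨?_, ?_, ?_⟩ <;> simp only [cross] <;> nlinarith

lemma interior_nonempty {P p : Finset Pt} (hgp : GenPos P) (hp : p ⊆ P) (hc : 3 ≤ p.card) :
    (interior (convexHull ℝ (p : Set Pt))).Nonempty := by
  obtain ⟨a, b, c, ha, hb, hc, hab, hac, hbc⟩ := Finset.two_lt_card_iff.1 hc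
  have hne := hgp a (hp ha) b (hp hb) c (hp hc) hab hbc hac
  have hh := subset_convexHull ℝ (p : Set Pt)
  rcases lt_or_gt_of_ne hne with h | h
  · refine interior_triangle (a := b) (b := a) (q := c) ?_ (convex_convexHull ℝ _)
      (hh hb) (hh ha) (hh hc)
    rw [cross_swap]; linarith
  · exact interior_triangle h (convex_convexHull ℝ _) (hh ha) (hh hb) (hh hc)

lemma dual_coord (f : StrongDual ℝ Pt) (z : Pt) : f z = f (1,0) * z.1 + f (0,1) * z.2 := by
  have : z = z.1 • ((1,0) : Pt) + z.2 • ((0,1) : Pt) := by ext <;> simp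
  conv_lhs => rw [this]
  rw [map_add, map_smul, map_smul]; simp [mul_comm]

lemma frontier_key {P p : Finset Pt} (hgp : GenPos P) (hp : p ⊆ P) (hc : 3 ≤ p.card) {w : Pt}
    (hw : w ∈ convexHull ℝ (p : Set Pt)) (hw' : w ∉ interior (convexHull ℝ (p : Set Pt))) :
    w ∈ p ∨ ∃ a ∈ p, ∃ b ∈ p, a ≠ b ∧ w ∈ segment ℝ a b ∧ ∀ q ∈ p, 0 ≤ cross a b q := by
  have hconv := convex_convexHull ℝ (p : Set Pt)
  have hint := interior_nonempty hgp hp hc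
  obtain ⟨f, hf⟩ := geometric_hahn_banach_open_point hconv.interior isOpen_interior hw'
  set α := f (1,0) with hα
  set β := f (0,1) with hβ
  have hfc : ∀ z, f z = α * z.1 + β * z.2 := dual_coord f
  have hne : 0 < α^2 + β^2 := by
    obtain ⟨z, hz⟩ := hint
    by_contra hcon
    have h1 : α = 0 := by nlinarith [sq_nonneg α, sq_nonneg β]
    have h2 : β = 0 := by nlinarith [sq_nonneg α, sq_nonneg β]
    have := hf z hz
    rw [hfc, hfc, h1, h2] at this; simp at this
  have hle : ∀ q ∈ p, f q ≤ f w := by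
    intro q hq
    have hq' : q ∈ closure (interior (convexHull ℝ (p : Set Pt))) := by
      rw [hconv.closure_interior_eq_closure_of_nonempty_interior hint]
      exact subset_closure (subset_convexHull ℝ _ hq)
    have hcl : IsClosed {z | f z ≤ f w} := isClosed_le f.continuous continuous_const
    exact closure_minimal (fun z hz => (hf z hz).le) hcl hq'
  obtain ⟨wt, h0, h1, h2⟩ := Finset.mem_convexHull'.1 hw
  have hz : ∀ q ∈ p, wt q * (f w - f q) = 0 := by
    refine (Finset.sum_eq_zero_iff_of_nonneg ?_).1 ?_
    · intro q hq; exact mul_nonneg (h0 q hq) (by linarith [hle q hq])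
    · simp only [mul_sub, Finset.sum_sub_distrib, ← Finset.sum_mul, h1]
      have : f w = ∑ q ∈ p, wt q * f q := by
        conv_lhs => rw [← h2]
        simp [map_sum]
      rw [← this]; ring
  set p' := p.filter (fun q => f q = f w) with hp'
  have hz' : ∀ q ∈ p, ¬ (f q = f w) → wt q = 0 := by
    intro q hq hn
    rcases mul_eq_zero.1 (hz q hq) with h | h
    · exact h
    · exact absurd (by linarith) hn
  have hw2 : w ∈ convexHull ℝ (p' : Set Pt) := by
    refine Finset.mem_convexHull'.2 ⟨wt, fun y hy => h0 y (Finset.mem_filter.1 hy).1, ?_, ?_⟩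
    · rw [← h1, hp', Finset.sum_filter_of_ne]
      intro q hq hn; by_contra hcon; exact hn (hz' q hq hcon)
    · rw [← h2, hp', Finset.sum_filter_of_ne]
      intro q hq hn; by_contra hcon; exact hn (by rw [hz' q hq hcon, zero_smul])
  have hcard : p'.card ≤ 2 := by
    by_contra hcon
    obtain ⟨a, b, c, ha, hb, hc, hab, hac, hbc⟩ := Finset.two_lt_card_iff.1 (not_le.1 hcon)
    rw [hp', Finset.mem_filter] at ha hb hc
    apply hgp a (hp ha.1) b (hp hb.1) c (hp hc.1) hab hbc hac
    have e1 : f b - f a = 0 := by rw [ha.2, hb.2]; ring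
    have e2 : f c - f b = 0 := by rw [hc.2, hb.2]; ring
    rw [hfc, hfc] at e1 e2
    have : (α^2+β^2) * cross a b c = 0 := by
      simp only [cross]
      linear_combination (α * (c.2 - b.2) - β * (c.1 - b.1)) * e1 + (β * (b.1 - a.1) - α * (b.2 - a.2)) * e2
    rcases mul_eq_zero.1 this with h | h
    · exact absurd h hne.ne'
    · exact h
  have hcases : p'.card = 0 ∨ p'.card = 1 ∨ p'.card = 2 := by omega
  rcases hcases with h | h | h
  · rw [Finset.card_eq_zero] at h
    rw [h] at hw2; simp at hw2
  · obtain ⟨a, ha⟩ := Finset.card_eq_one.1 h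
    rw [ha] at hw2
    simp at hw2
    left
    have : a ∈ p' := by rw [ha]; simp
    rw [hw2]; exact (Finset.mem_filter.1 this).1
  · obtain ⟨a, b, hab, he⟩ := Finset.card_eq_two.1 h
    right
    have ha : a ∈ p' := by rw [he]; simp
    have hb : b ∈ p' := by rw [he]; simp
    rw [he] at hw2
    simp only [Finset.coe_insert, Finset.coe_singleton, convexHull_pair] at hw2
    rw [hp', Finset.mem_filter] at ha hb
    have key : ∀ q, (α^2+β^2) * cross a b q
        = (α * (b.2 - a.2) - β * (b.1 - a.1)) * (f w - f q) := by
      intro q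
      have e1 : f b - f a = 0 := by rw [ha.2, hb.2]; ring
      have e2 := hb.2
      rw [← e2]
      rw [hfc, hfc] at e1 
      rw [hfc, hfc]
      simp only [cross]
      linear_combination (α * (q.2 - b.2) - β * (q.1 - b.1)) * e1
    rcases le_total 0 (α * (b.2 - a.2) - β * (b.1 - a.1)) with hs | hs
    · refine ⟨a, ha.1, b, hb.1, hab, hw2, fun q hq => ?_⟩
      have := key q
      have h3 := mul_nonneg hs (sub_nonneg.2 (hle q hq))
      rw [← this] at h3
      exact nonneg_of_mul_nonneg_right h3 hne
    · refine ⟨b, hb.1, a, ha.1, hab.symm, by rwa [segment_symm], fun q hq => ?_⟩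
      have := key q
      have h3 := mul_nonpos_of_nonpos_of_nonneg hs (sub_nonneg.2 (hle q hq))
      rw [← this] at h3
      rw [cross_swap]
      by_contra hcon
      have : 0 < cross a b q := by linarith
      have := mul_pos hne this
      linarith

/-- vertices of the arrangement -/
def vset (P : Finset Pt) : Set Pt :=
  {w | w ∈ P ∨ ∃ a ∈ P, ∃ b ∈ P, ∃ c ∈ P, ∃ d ∈ P, a ≠ b ∧ c ≠ d ∧ w ∈ segment ℝ a b ∧
    w ∈ segment ℝ c d ∧ ¬ ((c = a ∧ d = b) ∨ (c = b ∧ d = a))}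

lemma gp_mem {P : Finset Pt} (hgp : GenPos P) {a b c : Pt} (ha : a ∈ P) (hb : b ∈ P) (hc : c ∈ P)
    (hab : a ≠ b) (h : cross a b c = 0) : c = a ∨ c = b := by
  by_contra hcon
  push Not at hcon
  exact hgp a ha b hb c hc hab hcon.2.symm hcon.1.symm h

lemma seg_inter {P : Finset Pt} (hgp : GenPos P) {a b c d x y : Pt} (ha : a ∈ P) (hb : b ∈ P)
    (hc : c ∈ P) (hd : d ∈ P) (hab : a ≠ b) (hcd : c ≠ d) (hx : x ∈ segment ℝ a b)
    (hy : y ∈ segment ℝ a b) (hx' : x ∈ segment ℝ c d) (hy' : y ∈ segment ℝ c d) (hxy : x ≠ y) :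
    (c = a ∧ d = b) ∨ (c = b ∧ d = a) := by
  have h1 := cross_of_mem_segment hx
  have h2 := cross_of_mem_segment hy
  obtain ⟨s, t, hs, ht, hst, rfl⟩ := hx'
  obtain ⟨s', t', hs', ht', hst', rfl⟩ := hy'
  rw [cross_combo _ _ _ _ _ _ hst] at h1
  rw [cross_combo _ _ _ _ _ _ hst'] at h2
  have hne : t ≠ t' := by
    rintro rfl
    obtain rfl : s = s' := by linarith
    exact hxy rfl
  obtain rfl : s = 1 - t := by linarith
  obtain rfl : s' = 1 - t' := by linarith
  have h3 : (t - t') * (cross a b d - cross a b c) = 0 := by linear_combination h1 - h2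
  have h4 : cross a b d - cross a b c = 0 := by
    rcases mul_eq_zero.1 h3 with h | h
    · exact absurd (by linarith) hne
    · exact h
  have hC : cross a b c = 0 := by linear_combination h1 - t * h4
  have hD : cross a b d = 0 := by linarith
  rcases gp_mem hgp ha hb hc hab hC with rfl | rfl <;>
    rcases gp_mem hgp ha hb hd hab hD with rfl | rfl
  · exact absurd rfl hcd
  · exact Or.inl ⟨rfl, rfl⟩
  · exact Or.inr ⟨rfl, rfl⟩
  · exact absurd rfl hcd

lemma vset_finite {P : Finset Pt} (hgp : GenPos P) : (vset P).Finite := by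
  have : vset P ⊆ (P : Set Pt) ∪ ⋃ a ∈ P, ⋃ b ∈ P, ⋃ c ∈ P, ⋃ d ∈ P,
      {w | a ≠ b ∧ c ≠ d ∧ w ∈ segment ℝ a b ∧
    w ∈ segment ℝ c d ∧ ¬ ((c = a ∧ d = b) ∨ (c = b ∧ d = a))} := by
    rintro w (h | ⟨a, ha, b, hb, c, hc, d, hd, h⟩)
    · exact Or.inl h
    · right
      simp only [Set.mem_iUnion]
      exact ⟨a, ha, b, hb, c, hc, d, hd, h⟩
  refine Set.Finite.subset (Set.Finite.union P.finite_toSet ?_) this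
  refine P.finite_toSet.biUnion fun a ha => P.finite_toSet.biUnion fun b hb =>
    P.finite_toSet.biUnion fun c hc => P.finite_toSet.biUnion fun d hd => ?_
  apply Set.Subsingleton.finite
  rintro x ⟨h1, h2, h3, h4, h5⟩ y ⟨_, _, h3', h4', _⟩
  by_contra hxy
  exact h5 (seg_inter hgp ha hb hc hd h1 h2 h3 h3' h4 h4' hxy)

lemma mem_arr {P : Finset Pt} {z : Pt} :
    z ∈ arrUnion P ↔ ∃ a ∈ P, ∃ b ∈ P, z ∈ segment ℝ a b := by
  simp [arrUnion]

lemma isClosed_seg (a b : Pt) : IsClosed (segment ℝ a b) := by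
  rw [← convexHull_pair]
  exact (Set.toFinite {a, b}).isClosed_convexHull ℝ

lemma isClosed_arr (P : Finset Pt) : IsClosed (arrUnion P) :=
  P.finite_toSet.isClosed_biUnion fun a _ => P.finite_toSet.isClosed_biUnion fun b _ =>
    isClosed_seg a b

lemma isClosed_hull (p : Finset Pt) : IsClosed (convexHull ℝ (p : Set Pt)) :=
  p.finite_toSet.isClosed_convexHull ℝ

/-- generic points: off all lines -/
def gset (P : Finset Pt) : Set Pt := {z | ∀ a ∈ P, ∀ b ∈ P, z ∉ line[ℝ, a, b]}

lemma gset_dense (P : Finset Pt) : Dense (gset P) := by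
  have : ∀ᵐ z : Pt ∂MeasureTheory.volume, ∀ a ∈ P, ∀ b ∈ P, z ∉ line[ℝ, a, b] := by
    rw [eventually_all_finset]
    intro a _
    rw [eventually_all_finset]
    intro b _
    have := MeasureTheory.Measure.addHaar_affineSubspace (MeasureTheory.volume : MeasureTheory.Measure Pt) line[ℝ, a, b] ?_
    · rw [MeasureTheory.ae_iff]; simpa using this
    · intro h
      have hc := collinear_pair ℝ a b
      have h2 : Module.finrank ℝ (vectorSpan ℝ ({a, b} : Set Pt)) ≤ 1 := hc.finrank_le_one
      rw [← direction_affineSpan, h] at h2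
      rw [AffineSubspace.direction_top, finrank_top] at h2
      norm_num [Module.finrank_prod] at h2
  exact MeasureTheory.Measure.dense_of_ae this

lemma gset_not_arr {P : Finset Pt} {z : Pt} (hz : z ∈ gset P) : z ∉ arrUnion P := by
  intro h
  obtain ⟨a, ha, b, hb, h⟩ := mem_arr.1 h
  rw [segment_eq_image_lineMap] at h
  obtain ⟨t, -, rfl⟩ := h
  exact hz a ha b hb (AffineMap.lineMap_mem_affineSpan_pair t a b)

lemma gset_cross {P : Finset Pt} {z a b : Pt} (hz : z ∈ gset P) (ha : a ∈ P) (hb : b ∈ P)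
    (hab : a ≠ b) : cross a b z ≠ 0 := by
  intro h
  obtain ⟨t, rfl⟩ := exists_of_cross_zero hab h
  exact hz a ha b hb (AffineMap.lineMap_mem_affineSpan_pair t a b)

/-- `p` has edge `ab` and lies left of it -/
def PosE (a b : Pt) (p : Finset Pt) : Prop := a ∈ p ∧ b ∈ p ∧ ∀ q ∈ p, 0 ≤ cross a b q

lemma exists_third {P p : Finset Pt} (hgp : GenPos P) (hp : p ⊆ P) (hc : 3 ≤ p.card) {a b : Pt}
    (hab : a ≠ b) (h : PosE a b p) : ∃ q ∈ p, 0 < cross a b q := by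
  have : ∃ q ∈ p, q ∉ ({a, b} : Finset Pt) := by
    by_contra hcon
    push Not at hcon
    have := Finset.card_le_card (show p ⊆ {a, b} from hcon)
    have := Finset.card_le_two (a := a) (b := b)
    omega
  obtain ⟨q, hq, hn⟩ := this
  refine ⟨q, hq, lt_of_le_of_ne (h.2.2 q hq) fun he => ?_⟩
  rcases gp_mem hgp (hp h.1) (hp h.2.1) (hp hq) hab he.symm with rfl | rfl <;> simp at hn

lemma local_pos {P p : Finset Pt} (hgp : GenPos P) (hp : p ⊆ P) (hc : 3 ≤ p.card) {a b w : Pt}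
    (hab : a ≠ b) (h : PosE a b p) (hw : w ∈ segment ℝ a b) (hwa : w ≠ a) (hwb : w ≠ b) :
    ∀ᶠ z in 𝓝 w, cross a b z ≠ 0 → (z ∈ convexHull ℝ (p : Set Pt) ↔ 0 < cross a b z) := by
  obtain ⟨q, hq, hpos⟩ := exists_third hgp hp hc hab h
  have e1 : cross b q a = cross a b q := cross_rot a b q
  have e2 : cross q a b = cross a b q := by rw [← e1]; exact cross_rot b q a
  obtain ⟨s, t, hs, ht, hst, rfl⟩ := hw
  have hs' : 0 < s := by
    refine lt_of_le_of_ne hs fun he => hwb ?_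
    subst he
    obtain rfl : t = 1 := by linarith
    simp
  have ht' : 0 < t := by
    refine lt_of_le_of_ne ht fun he => hwa ?_
    subst he
    obtain rfl : s = 1 := by linarith
    simp
  have c1 : 0 < cross b q (s • a + t • b) := by
    rw [cross_combo _ _ _ _ _ _ hst, e1, cross_left]; positivity
  have c2 : 0 < cross q a (s • a + t • b) := by
    rw [cross_combo _ _ _ _ _ _ hst, e2, cross_right]; positivity
  have hh := subset_convexHull ℝ (p : Set Pt)
  filter_upwards [(cross_cont b q).continuousAt.eventually (lt_mem_nhds c1),
    (cross_cont q a).continuousAt.eventually (lt_mem_nhds c2)] with z z1 z2 z0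
  constructor
  · intro hz
    have : z ∈ {z | 0 ≤ cross a b z} :=
      convexHull_min (fun q hq => h.2.2 q hq) (convex_cross_nonneg a b) hz
    exact lt_of_le_of_ne this z0.symm
  · intro hz
    exact mem_triangle hpos (le_of_lt z1) (le_of_lt z2) hz.le (convex_convexHull ℝ _)
      (hh h.1) (hh h.2.1) (hh hq)

lemma ev_const {S : Set Pt} (hS : IsClosed S) {w : Pt} (h : w ∈ S → w ∈ interior S) :
    ∀ᶠ z in 𝓝 w, (z ∈ S ↔ w ∈ S) := by
  by_cases hw : w ∈ S
  · filter_upwards [mem_interior_iff_mem_nhds.1 (h hw)] with z hz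
    simp [hw, hz]
  · filter_upwards [hS.isOpen_compl.mem_nhds hw] with z hz
    simp only [hw, iff_false]; exact hz

lemma local_poly {P p : Finset Pt} (hgp : GenPos P) (hp : p ⊆ P) (hc : 3 ≤ p.card) {a b w : Pt}
    (ha : a ∈ P) (hb : b ∈ P)
    (hab : a ≠ b) (hw : w ∈ segment ℝ a b) (hwV : w ∉ vset P) :
    ∃ k : ℤ, ∀ᶠ z in 𝓝 w, cross a b z ≠ 0 →
      (if z ∈ convexHull ℝ (p : Set Pt) then 1 else 0 : ℤ) = k +
        if 0 < cross a b z then (if PosE a b p then 1 else 0)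
          else (if PosE b a p then 1 else 0) := by
  have hwP : w ∉ P := fun h => hwV (Or.inl h)
  have hwa : w ≠ a := fun h => hwP (h ▸ ha)
  have hwb : w ≠ b := fun h => hwP (h ▸ hb)
  by_cases h1 : PosE a b p
  · have h2 : ¬ PosE b a p := by
      intro h2
      obtain ⟨q, hq, hpos⟩ := exists_third hgp hp hc hab h1
      have := h2.2.2 q hq
      rw [cross_swap] at this; linarith
    refine ⟨0, ?_⟩
    filter_upwards [local_pos hgp hp hc hab h1 hw hwa hwb] with z hz h0
    simp [hz h0, h1, h2]
  by_cases h2 : PosE b a p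
  · refine ⟨0, ?_⟩
    rw [segment_symm] at hw
    filter_upwards [local_pos hgp hp hc hab.symm h2 hw hwb hwa] with z hz h0
    have := hz (by rw [cross_swap]; simpa using h0)
    rw [cross_swap] at this
    rcases lt_or_gt_of_ne h0 with h | h
    · simp [this, h1, h2, h, h.le]
    · simp [this, h1, h2, h, h.le]
  have hint : w ∈ convexHull ℝ (p : Set Pt) → w ∈ interior (convexHull ℝ (p : Set Pt)) := by
    intro hwC
    by_contra hcon
    rcases frontier_key hgp hp hc hwC hcon with h | ⟨c, hc', d, hd', hcd, hws, hq⟩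
    · exact hwP (hp h)
    · have : (c = a ∧ d = b) ∨ (c = b ∧ d = a) := by
        by_contra hx
        exact hwV (Or.inr ⟨a, ha, b, hb, c, hp hc', d, hp hd', hab, hcd, hw, hws, hx⟩)
      rcases this with ⟨rfl, rfl⟩ | ⟨rfl, rfl⟩
      · exact h1 ⟨hc', hd', hq⟩
      · exact h2 ⟨hc', hd', hq⟩
  refine ⟨if w ∈ convexHull ℝ (p : Set Pt) then 1 else 0, ?_⟩
  filter_upwards [ev_const (isClosed_hull p) hint] with z hz h0
  simp [hz, h1, h2]

lemma local_multi {P : Finset Pt} (hgp : GenPos P) {a b w : Pt}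
    (ha : a ∈ P) (hb : b ∈ P)
    (hab : a ≠ b) (hw : w ∈ segment ℝ a b) (hwV : w ∉ vset P) (U : Multiset (Finset Pt))
    (hU : ∀ p ∈ U, p ⊆ P ∧ 3 ≤ p.card) :
    ∃ k : ℤ, ∀ᶠ z in 𝓝 w, cross a b z ≠ 0 →
      (Multiset.countP (fun p : Finset Pt => z ∈ convexHull ℝ (p : Set Pt)) U : ℤ) = k +
        if 0 < cross a b z then (Multiset.countP (PosE a b) U : ℤ)
          else (Multiset.countP (PosE b a) U : ℤ) := by
  induction U using Multiset.induction_on with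
  | empty => exact ⟨0, by simp⟩
  | cons p U ih =>
    obtain ⟨k, hk⟩ := ih fun q hq => hU q (Multiset.mem_cons_of_mem hq)
    have hp := hU p (Multiset.mem_cons_self p U)
    obtain ⟨k', hk'⟩ := local_poly hgp hp.1 hp.2 ha hb hab hw hwV
    refine ⟨k + k', ?_⟩
    filter_upwards [hk, hk'] with z h1 h2 h0
    have h1 := h1 h0
    have h2 := h2 h0
    simp only [Multiset.countP_cons, Nat.cast_add, Nat.cast_ite, Nat.cast_one, Nat.cast_zero]
    rw [h1, h2]
    split_ifs <;> ring

lemma frontier_arr {P p : Finset Pt} (hgp : GenPos P) (hp : p ⊆ P) (hc : 3 ≤ p.card) {w : Pt}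
    (hw : w ∈ convexHull ℝ (p : Set Pt)) (hwa : w ∉ arrUnion P) :
    w ∈ interior (convexHull ℝ (p : Set Pt)) := by
  by_contra hcon
  apply hwa
  rw [mem_arr]
  rcases frontier_key hgp hp hc hw hcon with h | ⟨c, hc', d, hd', hcd, hws, hq⟩
  · exact ⟨w, hp h, w, hp h, left_mem_segment ℝ w w⟩
  · exact ⟨c, hp hc', d, hp hd', hws⟩

lemma local_off {P : Finset Pt} (hgp : GenPos P) {w : Pt} (hw : w ∉ arrUnion P)
    (U : Multiset (Finset Pt)) (hU : ∀ p ∈ U, p ⊆ P ∧ 3 ≤ p.card) :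
    ∀ᶠ z in 𝓝 w, (Multiset.countP (fun p : Finset Pt => z ∈ convexHull ℝ (p : Set Pt)) U) =
      Multiset.countP (fun p : Finset Pt => w ∈ convexHull ℝ (p : Set Pt)) U := by
  induction U using Multiset.induction_on with
  | empty => simp
  | cons p U ih =>
    have hp := hU p (Multiset.mem_cons_self p U)
    filter_upwards [ih fun q hq => hU q (Multiset.mem_cons_of_mem hq),
      ev_const (isClosed_hull p) (w := w) fun h => frontier_arr hgp hp.1 hp.2 h hw] with z h1 h2
    simp only [Multiset.countP_cons, h1, h2]

lemma preconn_sub {P p : Finset Pt} (hgp : GenPos P) (hp : p ⊆ P) (hc : 3 ≤ p.card) {T : Set Pt}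
    (hT : IsPreconnected T) (hTa : T ⊆ (arrUnion P)ᶜ) {x : Pt} (hx : x ∈ T)
    (hxC : x ∈ convexHull ℝ (p : Set Pt)) : T ⊆ convexHull ℝ (p : Set Pt) := by
  refine (IsPreconnected.subset_left_of_subset_union isOpen_interior
    (isClosed_hull p).isOpen_compl ?_ ?_ ⟨x, hx, frontier_arr hgp hp hc hxC (hTa hx)⟩ hT).trans
    interior_subset
  · exact disjoint_compl_right.mono_left interior_subset
  · intro z hz
    by_cases h : z ∈ convexHull ℝ (p : Set Pt)
    · exact Or.inl (frontier_arr hgp hp hc h (hTa hz))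
    · exact Or.inr h

lemma unbounded_ray {P : Finset Pt} {x v : Pt} (hv : v ≠ 0)
    (h : ∀ t : ℝ, 0 ≤ t → x + t • v ∉ arrUnion P) :
    ¬ Bornology.IsBounded (connectedComponentIn (arrUnion P)ᶜ x) := by
  intro hb
  have hsub : (fun t : ℝ => x + t • v) '' Set.Ici 0 ⊆ connectedComponentIn (arrUnion P)ᶜ x := by
    apply IsPreconnected.subset_connectedComponentIn
    · exact isPreconnected_Ici.image _ (by fun_prop)
    · exact ⟨0, by simp, by simp⟩
    · rintro _ ⟨t, ht, rfl⟩; exact h t ht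
  obtain ⟨R, hR⟩ := (hb.subset hsub).exists_norm_le
  have hn : 0 < ‖v‖ := norm_pos_iff.2 hv
  have hR0 : 0 ≤ R := (norm_nonneg _).trans (hR (x + (0:ℝ) • v) ⟨0, by simp, rfl⟩)
  have h1 := hR (x + ((R + ‖x‖ + 1) / ‖v‖) • v) ⟨_, by simp only [Set.mem_Ici]; positivity, rfl⟩
  have h2 : ‖((R + ‖x‖ + 1) / ‖v‖) • v‖ = R + ‖x‖ + 1 := by
    rw [norm_smul, Real.norm_of_nonneg (by positivity)]; field_simp
  have h3 : ‖((R + ‖x‖ + 1) / ‖v‖) • v‖ ≤ ‖x + ((R + ‖x‖ + 1) / ‖v‖) • v‖ + ‖x‖ := by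
    have := norm_sub_le (x + ((R + ‖x‖ + 1) / ‖v‖) • v) x
    simpa using this
  linarith

lemma arr_sub_hull (P : Finset Pt) : arrUnion P ⊆ convexHull ℝ (P : Set Pt) := by
  intro z hz
  obtain ⟨a, ha, b, hb, h⟩ := mem_arr.1 hz
  exact (convex_convexHull ℝ _).segment_subset (subset_convexHull ℝ _ ha)
    (subset_convexHull ℝ _ hb) h

lemma bounded_mem_hull {P : Finset Pt} {x : Pt}
    (hb : Bornology.IsBounded (connectedComponentIn (arrUnion P)ᶜ x)) :
    x ∈ convexHull ℝ (P : Set Pt) := by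
  by_contra hx
  obtain ⟨f, u, hf, hu⟩ := geometric_hahn_banach_closed_point (convex_convexHull ℝ (P : Set Pt))
    (isClosed_hull P) hx
  rcases P.eq_empty_or_nonempty with rfl | ⟨o, ho⟩
  · refine unbounded_ray (x := x) (v := (1,0)) (by simp) ?_ hb
    simp [arrUnion]
  · have ho' := hf o (subset_convexHull ℝ _ ho)
    have hpos : 0 < f (x - o) := by rw [map_sub]; linarith
    refine unbounded_ray (x := x) (v := x - o) (fun h => ?_) (fun t ht h => ?_) hb
    · rw [h, map_zero] at hpos; exact lt_irrefl _ hpos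
    · have h1 := hf _ (arr_sub_hull P h)
      rw [map_add, map_smul, smul_eq_mul] at h1
      nlinarith

lemma hull_small {P : Finset Pt} (h : P.card < 3) : convexHull ℝ (P : Set Pt) ⊆ arrUnion P := by
  have hcases : P.card = 0 ∨ P.card = 1 ∨ P.card = 2 := by omega
  intro w hw
  rw [mem_arr]
  rcases hcases with h | h | h
  · rw [Finset.card_eq_zero] at h
    rw [h] at hw; simp at hw
  · obtain ⟨a, rfl⟩ := Finset.card_eq_one.1 h
    simp at hw
    subst hw
    exact ⟨w, by simp, w, by simp, left_mem_segment ℝ w w⟩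
  · obtain ⟨a, b, hab, rfl⟩ := Finset.card_eq_two.1 h
    simp only [Finset.coe_insert, Finset.coe_singleton, convexHull_pair] at hw
    exact ⟨a, by simp, b, by simp, hw⟩

/-- Near a point of `P`, every face is a wedge. -/
lemma wedge_near {P : Finset Pt} (hgp : GenPos P) {a : Pt} (ha : a ∈ P) :
    ∀ᶠ x in 𝓝 a, x ∉ arrUnion P → a ∈ closure (connectedComponentIn (arrUnion P)ᶜ x) := by
  have hev : ∀ᶠ z in 𝓝 a, (∀ c ∈ P, z = c → a = c) ∧
      ∀ c ∈ P, ∀ d ∈ P, z ∈ segment ℝ c d → a ∈ segment ℝ c d := by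
    refine Filter.Eventually.and ?_ ?_
    · rw [eventually_all_finset]
      intro c _
      by_cases h : a = c
      · simp [h]
      · filter_upwards [isOpen_ne.mem_nhds h] with z hz h'
        exact absurd h' hz
    · rw [eventually_all_finset]
      intro c _
      rw [eventually_all_finset]
      intro d _
      by_cases h : a ∈ segment ℝ c d
      · simp [h]
      · filter_upwards [(isClosed_seg c d).isOpen_compl.mem_nhds h] with z hz h'
        exact absurd h' hz
  obtain ⟨r, hr, hball⟩ := Metric.eventually_nhds_iff_ball.1 hev
  filter_upwards [Metric.ball_mem_nhds a hr] with x hx hxa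
  have hin : ∀ t : ℝ, 0 < t → t ≤ 1 → a + t • (x - a) ∈ Metric.ball a r := by
    intro t h0 h1
    rw [mem_ball_iff_norm] at hx ⊢
    rw [add_sub_cancel_left, norm_smul, Real.norm_of_nonneg h0.le]
    nlinarith [norm_nonneg (x - a)]
  -- the half-open segment avoids the arrangement
  have hxne : x ≠ a := by
    rintro rfl
    exact hxa (mem_arr.2 ⟨x, ha, x, ha, left_mem_segment ℝ x x⟩)
  have main : ∀ d ∈ P, ∀ t : ℝ, 0 < t → t ≤ 1 → a + t • (x - a) ∉ segment ℝ a d := by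
    intro d hd t h0 h1 hm
    rw [segment_eq_image'] at hm
    obtain ⟨s, hs, he⟩ := hm
    have he : s • (d - a) = t • (x - a) := by simpa using he
    by_cases hst : s ≤ t
    · apply hxa
      refine mem_arr.2 ⟨a, ha, d, hd, ?_⟩
      rw [segment_eq_image']
      refine ⟨s / t, ⟨div_nonneg hs.1 h0.le, (div_le_one h0).2 hst⟩, ?_⟩
      have : (s / t) • (d - a) = x - a := by
        rw [div_eq_inv_mul, mul_smul, he, smul_smul, inv_mul_cancel₀ h0.ne', one_smul]
      simp only [this]; simp
    · push Not at hst
      have hs0 : 0 < s := h0.trans hst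
      have hd' : d = a + (t / s) • (x - a) := by
        rw [div_eq_inv_mul, mul_smul, ← he, smul_smul, inv_mul_cancel₀ hs0.ne', one_smul]; simp
      have hb := hin (t / s) (by positivity) ((div_le_one hs0).2 hst.le)
      have had := (hball _ hb).1 d hd hd'.symm
      subst had
      rw [sub_self, smul_zero] at he
      rcases smul_eq_zero.1 he.symm with h | h
      · exact h0.ne' h
      · exact hxne (sub_eq_zero.1 h)
  have hsub : (fun t : ℝ => a + t • (x - a)) '' Set.Ioc 0 1 ⊆
      connectedComponentIn (arrUnion P)ᶜ x := by
    apply IsPreconnected.subset_connectedComponentIn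
    · exact isPreconnected_Ioc.image _ (by fun_prop)
    · exact ⟨1, by simp, by simp⟩
    · rintro _ ⟨t, ht, rfl⟩ hm
      obtain ⟨c, hc, d, hd, hcd⟩ := mem_arr.1 hm
      have hacd := (hball _ (hin t ht.1 ht.2)).2 c hc d hd hcd
      by_cases hne : c = d
      · subst hne
        simp at hacd
        subst hacd
        exact main a ha t ht.1 ht.2 hcd
      · rcases gp_mem hgp hc hd ha hne (cross_of_mem_segment hacd) with h | h
        · subst h
          exact main d hd t ht.1 ht.2 hcd
        · subst h
          rw [segment_symm] at hcd
          exact main c hc t ht.1 ht.2 hcd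
  refine closure_mono hsub ?_
  have hcont : Continuous (fun t : ℝ => a + t • (x - a)) := by fun_prop
  have h0 : (0:ℝ) ∈ closure (Set.Ioc (0:ℝ) 1) := by
    rw [closure_Ioc (by norm_num)]; simp
  have := image_closure_subset_closure_image hcont (Set.mem_image_of_mem _ h0)
  simpa using this

lemma bridge (U : Multiset (Finset Pt)) (F : Set Pt) :
    Multiset.countP (fun p => F ⊆ convexHull ℝ (p : Set Pt)) U =
      Multiset.countP (fun p : Finset Pt => F ⊆ convexHull ℝ (p : Set Pt)) U := by
  have : (do let a ← U; pure (a : Set Pt)) = U.map (fun a : Finset Pt => (a : Set Pt)) := by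
    simp only [Multiset.bind_def, Multiset.pure_def, Multiset.bind_singleton]
  rw [this, Multiset.countP_map, Multiset.countP_eq_card_filter]

/-- covering number -/
noncomputable def cnt (U : Multiset (Finset Pt)) (z : Pt) : ℕ :=
  Multiset.countP (fun p : Finset Pt => z ∈ convexHull ℝ (p : Set Pt)) U

lemma near_vertex {P : Finset Pt} (hgp : GenPos P) (hP : 3 ≤ P.card) {U : Multiset (Finset Pt)}
    (hU : ∀ p ∈ U, p ⊆ P ∧ 3 ≤ p.card)
    (hwedge : ∀ F : Set Pt, IsBoundedFace P F → (∃ i ∈ P, i ∈ closure F) →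
      Multiset.countP (fun p : Finset Pt => F ⊆ convexHull ℝ (p : Set Pt)) U = 1) {a : Pt} (ha : a ∈ P) :
    ∀ᶠ x in 𝓝 a, x ∉ arrUnion P → cnt U x = cnt {P} x := by
  filter_upwards [wedge_near hgp ha] with x hx hxa
  have hmem := mem_connectedComponentIn (F := (arrUnion P)ᶜ) (x := x) hxa
  have hpre := isPreconnected_connectedComponentIn (F := (arrUnion P)ᶜ) (x := x)
  have hsub := connectedComponentIn_subset (arrUnion P)ᶜ x
  by_cases hxP : x ∈ convexHull ℝ (P : Set Pt)
  · have hb : Bornology.IsBounded (connectedComponentIn (arrUnion P)ᶜ x) :=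
      (P.finite_toSet.isCompact_convexHull ℝ).isBounded.subset
        (preconn_sub hgp subset_rfl hP hpre hsub hmem hxP)
    have := hwedge _ ⟨⟨x, hxa, rfl⟩, hb⟩ ⟨a, ha, hx hxa⟩
    have h2 : cnt {P} x = 1 := by
      unfold cnt
      rw [← Multiset.cons_zero, Multiset.countP_cons]; simp [hxP]
    rw [h2, ← this]
    unfold cnt
    apply Multiset.countP_congr rfl
    intro p hp
    exact propext ⟨fun h => preconn_sub hgp (hU p hp).1 (hU p hp).2 hpre hsub hmem h,
      fun h => h hmem⟩
  · have h2 : cnt {P} x = 0 := by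
      unfold cnt
      rw [← Multiset.cons_zero, Multiset.countP_cons]; simp [hxP]
    rw [h2]
    unfold cnt
    rw [Multiset.countP_eq_zero]
    intro p hp h
    exact hxP (convexHull_mono (Finset.coe_subset.2 (hU p hp).1) h)

lemma exists_side {P : Finset Pt} {a b y : Pt} (hab : a ≠ b) (hy : cross a b y = 0)
    {p : Pt → Prop} (h : ∀ᶠ z in 𝓝 y, p z) :
    ∃ z ∈ gset P, p z ∧ 0 < cross a b z := by
  obtain ⟨O, hO, hOo, hyO⟩ := eventually_nhds_iff.1 h
  have hop : IsOpen (O ∩ {z | 0 < cross a b z}) :=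
    hOo.inter (isOpen_lt continuous_const (cross_cont a b))
  have hne : (O ∩ {z | 0 < cross a b z}).Nonempty := by
    have hcont : Continuous (fun s : ℝ => y + s • ((-(b.2 - a.2), b.1 - a.1) : Pt)) := by fun_prop
    have : ∀ᶠ s : ℝ in 𝓝[>] 0, y + s • ((-(b.2 - a.2), b.1 - a.1) : Pt) ∈ O := by
      apply nhdsWithin_le_nhds
      apply hcont.continuousAt.eventually
      apply hOo.mem_nhds
      simpa using hyO
    obtain ⟨s, hs, hs0⟩ := (this.and self_mem_nhdsWithin).exists
    refine ⟨_, hs, ?_⟩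
    have hp := mul_pos (show (0:ℝ) < s from hs0) (sq_pos_of_ne hab)
    have : cross a b (y + s • ((-(b.2 - a.2), b.1 - a.1) : Pt)) =
      cross a b y + s * ((b.1 - a.1)^2 + (b.2 - a.2)^2) := by
      simp only [cross, Prod.fst_add, Prod.snd_add, Prod.smul_fst, Prod.smul_snd, smul_eq_mul]
      ring
    simp only [Set.mem_ofPred_eq]
    rw [this, hy]; linarith
  obtain ⟨z, hz, hg⟩ := (gset_dense P).inter_open_nonempty _ hop hne
  exact ⟨z, hg, hO z hz.1, hz.2⟩

lemma local_main {P : Finset Pt} (hgp : GenPos P) (hP : 3 ≤ P.card) {U : Multiset (Finset Pt)}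
    (hU : ∀ p ∈ U, p ⊆ P ∧ 3 ≤ p.card)
    (hwedge : ∀ F : Set Pt, IsBoundedFace P F → (∃ i ∈ P, i ∈ closure F) →
      Multiset.countP (fun p : Finset Pt => F ⊆ convexHull ℝ (p : Set Pt)) U = 1) {w : Pt}
    (hw : w ∉ vset P) :
    ∃ k : ℤ, ∀ᶠ z in 𝓝 w, z ∈ gset P → (cnt U z : ℤ) - cnt {P} z = k := by
  have hU1 : ∀ p ∈ ({P} : Multiset (Finset Pt)), p ⊆ P ∧ 3 ≤ p.card := by
    intro p hp
    rw [Multiset.mem_singleton] at hp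
    subst hp; exact ⟨subset_rfl, hP⟩
  by_cases hwa : w ∈ arrUnion P
  swap
  · refine ⟨(cnt U w : ℤ) - cnt {P} w, ?_⟩
    filter_upwards [local_off hgp hwa U hU, local_off hgp hwa {P} hU1] with z h1 h2 _
    unfold cnt
    rw [h1, h2]
  obtain ⟨a, ha, b, hb, hws⟩ := mem_arr.1 hwa
  have hwP : w ∉ P := fun h => hw (Or.inl h)
  have hab : a ≠ b := by
    rintro rfl
    simp at hws
    exact hwP (hws ▸ ha)
  -- a point near `a` on the segment
  have hV : ∀ᶠ z in 𝓝 a, z ∈ vset P → z = a := by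
    have hc : IsClosed (vset P \ {a}) := ((vset_finite hgp).subset Set.sdiff_subset).isClosed
    filter_upwards [hc.isOpen_compl.mem_nhds (show a ∉ vset P \ {a} by simp)] with z hz hz'
    by_contra hne
    exact hz ⟨hz', hne⟩
  have hN := near_vertex hgp hP hU hwedge ha
  have hcont : Continuous (fun t : ℝ => a + t • (b - a)) := by fun_prop
  have hev : ∀ᶠ t : ℝ in 𝓝[>] 0, (a + t • (b - a) ∈ vset P → a + t • (b - a) = a) ∧
      ∀ᶠ x in 𝓝 (a + t • (b - a)), x ∉ arrUnion P → cnt U x = cnt {P} x := by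
    apply nhdsWithin_le_nhds
    have ht : Tendsto (fun t : ℝ => a + t • (b - a)) (𝓝 0) (𝓝 a) := by
      simpa using hcont.tendsto 0
    exact ht.eventually (hV.and hN.eventually_nhds)
  obtain ⟨t, ⟨hy1, hy2⟩, ht0, ht1⟩ := (hev.and (Ioo_mem_nhdsGT (show (0:ℝ) < 1 by norm_num))).exists
  set y := a + t • (b - a) with hy
  have hyV : y ∉ vset P := by
    intro h
    have := hy1 h
    rw [hy, add_eq_left, smul_eq_zero, sub_eq_zero] at this
    rcases this with h | h
    · exact ht0.ne' h
    · exact hab h.symm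
  have hys : y ∈ segment ℝ a b := by
    rw [segment_eq_image']; exact ⟨t, ⟨ht0.le, ht1.le⟩, rfl⟩
  have hyc := cross_of_mem_segment hys
  obtain ⟨k1, hk1⟩ := local_multi hgp ha hb hab hys hyV U hU
  obtain ⟨k2, hk2⟩ := local_multi hgp ha hb hab hys hyV {P} hU1
  obtain ⟨z, hzg, ⟨⟨z1, z2⟩, z3⟩, hz⟩ := exists_side (P := P) hab hyc ((hk1.and hk2).and hy2)
  obtain ⟨z', hzg', ⟨⟨z1', z2'⟩, z3'⟩, hz'⟩ := exists_side (P := P) (a := b) (b := a) hab.symm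
    (by rw [cross_swap, hyc, neg_zero]) ((hk1.and hk2).and hy2)
  rw [cross_swap] at hz'
  have e1 := z1 hz.ne'
  have e2 := z2 hz.ne'
  have e3 := z3 (gset_not_arr hzg)
  have e1' := z1' (by linarith)
  have e2' := z2' (by linarith)
  have e3' := z3' (gset_not_arr hzg')
  rw [if_pos hz] at e1 e2
  rw [if_neg (by linarith)] at e1' e2'
  unfold cnt at e3 e3'
  obtain ⟨m1, hm1⟩ := local_multi hgp ha hb hab hws hw U hU
  obtain ⟨m2, hm2⟩ := local_multi hgp ha hb hab hws hw {P} hU1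
  refine ⟨m1 + (Multiset.countP (PosE a b) U : ℤ) - m2 - (Multiset.countP (PosE a b) {P} : ℤ), ?_⟩
  filter_upwards [hm1, hm2] with x h1 h2 hxg
  have hxc := gset_cross hxg ha hb hab
  have h1 := h1 hxc
  have h2 := h2 hxc
  unfold cnt
  rw [h1, h2]
  split_ifs
  · ring
  · rw [e3, e2] at e1
    rw [e3', e2'] at e1'
    linarith

/-- if a multiset of empty convex polygons covers every i-wedge exactly
once, then it covers every bounded face of the arrangement exactly once. -/
theorem stmt_11 (P : Finset Pt) (hgp : GenPos P) (U : Multiset (Finset Pt))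
    (hpoly : ∀ p ∈ U, IsEmptyPolygon P p)
    (hwedge : ∀ F : Set Pt, IsBoundedFace P F → (∃ i ∈ P, i ∈ closure F) →
      Multiset.countP (fun p => F ⊆ convexHull ℝ (p : Set Pt)) U = 1) :
    ∀ F : Set Pt, IsBoundedFace P F →
      Multiset.countP (fun p => F ⊆ convexHull ℝ (p : Set Pt)) U = 1 := by
  simp only [bridge] at hwedge ⊢
  intro F hF
  have hU : ∀ p ∈ U, p ⊆ P ∧ 3 ≤ p.card := fun p hp => ⟨(hpoly p hp).1, (hpoly p hp).2.1⟩
  obtain ⟨⟨x, hxa, rfl⟩, hb⟩ := hF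
  have hxP := bounded_mem_hull hb
  have hP : 3 ≤ P.card := by
    by_contra h
    exact hxa (hull_small (not_le.1 h) hxP)
  have hmem := mem_connectedComponentIn (F := (arrUnion P)ᶜ) (x := x) hxa
  have hpre := isPreconnected_connectedComponentIn (F := (arrUnion P)ᶜ) (x := x)
  have hsub := connectedComponentIn_subset (arrUnion P)ᶜ x
  have hop : IsOpen (connectedComponentIn (arrUnion P)ᶜ x) :=
    (isClosed_arr P).isOpen_compl.connectedComponentIn
  set F := connectedComponentIn (arrUnion P)ᶜ x with hFdef
  -- the global argument
  have hconn : IsPreconnected (vset P)ᶜ :=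
    ((vset_finite hgp).countable.isConnected_compl_of_one_lt_rank
      (by simp [← Module.finrank_eq_rank]; try norm_num)).isPreconnected
  let D : Pt → ℤ → Prop := fun w k => ∀ᶠ z in 𝓝 w, z ∈ gset P → (cnt U z : ℤ) - cnt {P} z = k
  have hDo : ∀ k, IsOpen {w | D w k} := by
    intro k
    rw [isOpen_iff_mem_nhds]
    intro w hw
    exact Filter.Eventually.eventually_nhds hw
  have hDu : ∀ w k k', D w k → D w k' → k = k' := by
    intro w k k' h h'
    obtain ⟨O, hO, hOo, hwO⟩ := eventually_nhds_iff.1 (h.and h')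
    obtain ⟨z, hz, hg⟩ := (gset_dense P).inter_open_nonempty _ hOo ⟨w, hwO⟩
    rw [← (hO z hz).1 hg, ← (hO z hz).2 hg]
  have hall : (vset P)ᶜ ⊆ {w | D w 0} := by
    refine IsPreconnected.subset_left_of_subset_union (hDo 0)
      (v := ⋃ k ∈ {k : ℤ | k ≠ 0}, {w | D w k}) (isOpen_biUnion fun k _ => hDo k) ?_ ?_ ?_ hconn
    · rw [Set.disjoint_left]
      intro w hw hw'
      simp only [Set.mem_iUnion] at hw'
      obtain ⟨k, hk, hw'⟩ := hw'
      exact hk (hDu w k 0 hw' hw)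
    · intro w hw
      obtain ⟨k, hk⟩ := local_main hgp hP hU hwedge hw
      by_cases h : k = 0
      · subst h; exact Or.inl hk
      · right
        simp only [Set.mem_iUnion]
        exact ⟨k, h, hk⟩
    · obtain ⟨a, ha⟩ : P.Nonempty := Finset.card_pos.1 (by omega)
      have hN := near_vertex hgp hP hU hwedge ha
      obtain ⟨O, hO, hOo, haO⟩ := eventually_nhds_iff.1 hN
      obtain ⟨z, hz, hg⟩ := (gset_dense P).inter_open_nonempty _ hOo ⟨a, haO⟩
      refine ⟨z, ?_, ?_⟩
      · rintro (h | ⟨a, ha, b, hb, c, hc, d, hd, -, -, h, -⟩)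
        · exact gset_not_arr hg (mem_arr.2 ⟨z, h, z, h, left_mem_segment ℝ z z⟩)
        · exact gset_not_arr hg (mem_arr.2 ⟨a, ha, b, hb, h⟩)
      · change ∀ᶠ z in 𝓝 z, z ∈ gset P → (cnt U z : ℤ) - cnt {P} z = 0
        filter_upwards [hOo.mem_nhds hz] with y hy hyg
        rw [hO y hy (gset_not_arr hyg), sub_self]
  have hxV : x ∉ vset P := by
    rintro (h | ⟨a, ha, b, hb, c, hc, d, hd, -, -, h, -⟩)
    · exact hxa (mem_arr.2 ⟨x, h, x, h, left_mem_segment ℝ x x⟩)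
    · exact hxa (mem_arr.2 ⟨a, ha, b, hb, h⟩)
  have hx0 : D x 0 := hall hxV
  obtain ⟨O, hO, hOo, hxO⟩ := eventually_nhds_iff.1 hx0
  obtain ⟨z, ⟨hzO, hzF⟩, hg⟩ :=
    (gset_dense P).inter_open_nonempty _ (hOo.inter hop) ⟨x, hxO, hmem⟩
  have h1 := hO z hzO hg
  have hzP : z ∈ convexHull ℝ (P : Set Pt) := preconn_sub hgp subset_rfl hP hpre hsub hmem hxP hzF
  have h2 : cnt {P} z = 1 := by
    unfold cnt
    rw [← Multiset.cons_zero, Multiset.countP_cons]; simp [hzP]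
  have h3 : cnt U z = 1 := by rw [h2] at h1; push_cast at h1; omega
  rw [← h3]
  unfold cnt
  apply Multiset.countP_congr rfl
  intro p hp
  exact propext ⟨fun h => h hzF,
    fun h => preconn_sub hgp (hU p hp).1 (hU p hp).2 hpre hsub hzF h⟩
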